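/- If p and q are acyclic MLL proof nets and p ⇒m q (parallel elimination of a family of multiplicative cuts), then jd(q) ≤ 2·jd(p). -/

import Mathlib

/- Formalization of untyped MLL proof nets with jumps, switching paths,
   and parallel cut elimination, following Chouquet & Vaux Auclair. -/

namespace MLLNets

attribute [local instance] Classical.propDecidable

/-- Trees of MLL nets: variables (axiom conclusions, paired by the involution
    `(n,b) ↦ (n,!b)`), labelled units `1_λ`, labelled counits `⊥_μ`, and
    n-ary connectives `⊗`, `⅋`. -/
inductive Tree : Type where
  | var : ℕ → Bool → Tree
  | unit : ℕ → Tree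
  | counit : ℕ → Tree
  | tens : List Tree → Tree
  | parr : List Tree → Tree

instance : Inhabited Tree := ⟨Tree.unit 0⟩

/-- Atoms: variables, unit labels, counit labels. -/
inductive Atom : Type where
  | var : ℕ → Bool → Atom
  | unit : ℕ → Atom
  | counit : ℕ → Atom

namespace Tree

/-- Number of subtrees of a tree. -/
def size : Tree → ℕ
  | var _ _ => 1
  | unit _ => 1
  | counit _ => 1
  | tens ts => 1 + (ts.attach.map (fun x => x.1.size)).sum
  | parr ts => 1 + (ts.attach.map (fun x => x.1.size)).sum
termination_by t => sizeOf t
decreasing_by all_goals (have h := List.sizeOf_lt_of_mem x.2; simp; omega)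

/-- The set of subtrees of a tree. -/
noncomputable def ST : Tree → Finset Tree
  | var n b => {var n b}
  | unit l => {unit l}
  | counit l => {counit l}
  | tens ts => insert (tens ts) ((ts.attach.map (fun x => x.1.ST)).foldr (· ∪ ·) ∅)
  | parr ts => insert (parr ts) ((ts.attach.map (fun x => x.1.ST)).foldr (· ∪ ·) ∅)
termination_by t => sizeOf t
decreasing_by all_goals (have h := List.sizeOf_lt_of_mem x.2; simp; omega)

/-- The multiset of atoms occurring in a tree. -/
def atoms : Tree → Multiset Atom
  | var n b => {Atom.var n b}
  | unit l => {Atom.unit l}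
  | counit l => {Atom.counit l}
  | tens ts => (ts.attach.map (fun x => x.1.atoms)).sum
  | parr ts => (ts.attach.map (fun x => x.1.atoms)).sum
termination_by t => sizeOf t
decreasing_by all_goals (have h := List.sizeOf_lt_of_mem x.2; simp; omega)

/-- Substitution of the tree `s` for the variable `(n, b)`. -/
def subst (n : ℕ) (b : Bool) (s : Tree) : Tree → Tree
  | var m c => if m = n ∧ c = b then s else var m c
  | unit l => unit l
  | counit l => counit l
  | tens ts => tens (ts.attach.map (fun x => Tree.subst n b s x.1))
  | parr ts => parr (ts.attach.map (fun x => Tree.subst n b s x.1))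
termination_by t => sizeOf t
decreasing_by all_goals (have h := List.sizeOf_lt_of_mem x.2; simp; omega)

/-- Iterated substitution `t[t₁/x̄₁]⋯[tₙ/x̄ₙ]`: each list entry `((n,b), s)`
    records an axiom cut `⟨x|s⟩` with `x = (n,b)`, and `s` is substituted
    for `x̄ = (n, !b)`. -/
def substList (l : List ((ℕ × Bool) × Tree)) (t : Tree) : Tree :=
  l.foldl (fun u e => u.subst e.1.1 (!e.1.2) e.2) t

end Tree

/-- A (bare) proof net with a jump function: a finite set of cuts, a finite
    family of conclusion trees, and a jump function assigning a tree to each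
    counit label. -/
structure Net : Type where
  cuts : Finset (Tree × Tree)
  concl : List Tree
  jump : ℕ → Tree

namespace Net

/-- The subtrees of a net. -/
noncomputable def ST (p : Net) : Finset Tree :=
  (p.cuts.biUnion fun c => c.1.ST ∪ c.2.ST) ∪ (p.concl.map Tree.ST).foldr (· ∪ ·) ∅

/-- The multiset of atoms of a net. -/
def atoms (p : Net) : Multiset Atom :=
  (p.cuts.val.map fun c => c.1.atoms + c.2.atoms).sum + (p.concl.map Tree.atoms).sum

/-- The counit labels occurring in a net. -/
noncomputable def counitLabels (p : Net) : Finset ℕ :=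
  p.ST.biUnion fun t => match t with | Tree.counit l => {l} | _ => ∅

/-- The size of a net: its number of subtrees. -/
def size (p : Net) : ℕ :=
  (p.cuts.sum fun c => c.1.size + c.2.size) + (p.concl.map Tree.size).sum

/-- Well-formedness: each atom occurs at most once, connectives have arity
    ≥ 1, variables are closed under the involution, and jumps of counits
    occurring in the net are subtrees of the net. -/
def IsMLL (p : Net) : Prop :=
  p.atoms.Nodup ∧
  (∀ ts, Tree.tens ts ∈ p.ST → ts ≠ []) ∧
  (∀ ts, Tree.parr ts ∈ p.ST → ts ≠ []) ∧
  (∀ n b, Atom.var n b ∈ p.atoms → Atom.var n (!b) ∈ p.atoms) ∧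
  (∀ m, Tree.counit m ∈ p.ST → p.jump m ∈ p.ST)

end Net

/-- Edges of switching graphs: axiom edges, ⊗-edges (one per premise),
    ⅋-edges (one per ⅋-tree, its other endpoint chosen by the switching),
    jump edges and cut edges. -/
inductive Edge : Type where
  | ax : ℕ → Edge
  | tensE : Tree → Tree → Edge
  | parrE : Tree → Edge
  | jumpE : ℕ → Edge
  | cutE : Tree → Tree → Edge

/-- A switching chooses a premise of each ⅋-subtree. -/
def Net.IsSwitching (p : Net) (I : Tree → Tree) : Prop :=
  ∀ ts, Tree.parr ts ∈ p.ST → I (Tree.parr ts) ∈ ts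

/-- Adjacency in the switching graph of `p` determined by the switching `I`. -/
inductive Net.Adj (p : Net) (I : Tree → Tree) : Edge → Tree → Tree → Prop
  | ax (n : ℕ) : Tree.var n true ∈ p.ST → Tree.var n false ∈ p.ST →
      Net.Adj p I (Edge.ax n) (Tree.var n true) (Tree.var n false)
  | tens {ts t} : Tree.tens ts ∈ p.ST → t ∈ ts →
      Net.Adj p I (Edge.tensE (Tree.tens ts) t) (Tree.tens ts) t
  | parr {ts} : Tree.parr ts ∈ p.ST →
      Net.Adj p I (Edge.parrE (Tree.parr ts)) (Tree.parr ts) (I (Tree.parr ts))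
  | jump {m} : Tree.counit m ∈ p.ST →
      Net.Adj p I (Edge.jumpE m) (Tree.counit m) (p.jump m)
  | cut {t s} : (t, s) ∈ p.cuts → Net.Adj p I (Edge.cutE t s) t s
  | symm {e t u} : Net.Adj p I e t u → Net.Adj p I e u t

/-- `IsTrail p I t l` : `l` is a switching path (a sequence of pairwise
    distinct consecutive edges, each paired with the vertex it reaches)
    starting from the subtree `t`. -/
inductive Net.IsTrail (p : Net) (I : Tree → Tree) : Tree → List (Edge × Tree) → Prop
  | nil (t) : t ∈ p.ST → Net.IsTrail p I t []
  | cons {t e u l} : Net.Adj p I e t u → Net.IsTrail p I u l → (∀ x ∈ l, x.1 ≠ e) →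
      Net.IsTrail p I t ((e, u) :: l)

/-- `ln p` : the maximal length of a switching path of `p`. -/
noncomputable def Net.ln (p : Net) : ℕ :=
  sSup {n | ∃ I t l, p.IsSwitching I ∧ p.IsTrail I t l ∧ l.length = n}

/-- `jd p` : the maximal number of counit labels jumping to a common
    subtree of `p`. -/
noncomputable def Net.jd (p : Net) : ℕ :=
  p.ST.sup fun t => (p.counitLabels.filter fun m => p.jump m = t).card

/-- A net is acyclic when no switching path visits the same subtree twice. -/
def Net.IsAcyclic (p : Net) : Prop :=
  ∀ I, p.IsSwitching I → ∀ t l, p.IsTrail I t l → (t :: l.map Prod.snd).Nodup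

/-! ### Parallel cut elimination -/

/-- Cuts of `p` eliminated by the multiplicative family `F` (given by the
    lists of premises of the ⊗- and ⅋-trees of each cut). -/
noncomputable def melim (F : Finset (List Tree × List Tree)) : Finset (Tree × Tree) :=
  F.biUnion fun c => {(Tree.tens c.1, Tree.parr c.2), (Tree.parr c.2, Tree.tens c.1)}

/-- Residual cuts produced by the multiplicative family `F`. -/
noncomputable def mres (F : Finset (List Tree × List Tree)) : Finset (Tree × Tree) :=
  F.biUnion fun c => (c.1.zip c.2).toFinset

/-- Cuts of `p` eliminated by an axiom family. -/
noncomputable def aelim (la : List ((ℕ × Bool) × Tree)) : Finset (Tree × Tree) :=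
  la.foldr (fun e s =>
    insert (Tree.var e.1.1 e.1.2, e.2) (insert (e.2, Tree.var e.1.1 e.1.2) s)) ∅

/-- Cuts of `p` eliminated by an evanescent family (pairs `(λ, μ)` of a unit
    and a counit label). -/
noncomputable def eelim (le : List (ℕ × ℕ)) : Finset (Tree × Tree) :=
  le.foldr (fun e s =>
    insert (Tree.unit e.1, Tree.counit e.2) (insert (Tree.counit e.2, Tree.unit e.1) s)) ∅

/-- The redirection function `ρ` for the parallel elimination of evanescent
    cuts: `Rho p le j t` holds when the jump of the `j`-th eliminated
    counit, followed along the chain of eliminated evanescent cuts, ends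
    at the tree `t`. -/
inductive Rho (p : Net) (le : List (ℕ × ℕ)) : ℕ → Tree → Prop
  | base (j : ℕ) :
      (∀ i < j, p.jump ((le.getD j (0,0)).2) ≠ Tree.counit ((le.getD i (0,0)).2) ∧
                p.jump ((le.getD j (0,0)).2) ≠ Tree.unit ((le.getD i (0,0)).1)) →
      Rho p le j (p.jump ((le.getD j (0,0)).2))
  | step {i j : ℕ} {t : Tree} : i < j →
      (p.jump ((le.getD j (0,0)).2) = Tree.counit ((le.getD i (0,0)).2) ∨
       p.jump ((le.getD j (0,0)).2) = Tree.unit ((le.getD i (0,0)).1)) →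
      Rho p le i t → Rho p le j t

/-- `ParStepF p q F la le` : `q` is obtained from `p` by the simultaneous
    elimination of the family `F` of multiplicative cuts, the family `la` of
    axiom cuts and the family `le` of evanescent cuts. -/
structure ParStepF (p q : Net) (F : Finset (List Tree × List Tree))
    (la : List ((ℕ × Bool) × Tree)) (le : List (ℕ × ℕ)) : Prop where
  /-- each member of `F` is a multiplicative cut of `p` -/
  hF : ∀ c ∈ F, c.1.length = c.2.length ∧ c.1 ≠ [] ∧
       ((Tree.tens c.1, Tree.parr c.2) ∈ p.cuts ∨ (Tree.parr c.2, Tree.tens c.1) ∈ p.cuts)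
  /-- each member of `la` is an axiom cut of `p` -/
  ha : ∀ e ∈ la, (Tree.var e.1.1 e.1.2, e.2) ∈ p.cuts ∨ (e.2, Tree.var e.1.1 e.1.2) ∈ p.cuts
  haN : (la.map Prod.fst).Nodup
  /-- `x̄ᵢ ∉ {x₁, …, xₙ}` -/
  haBar : ∀ e ∈ la, (e.1.1, !e.1.2) ∉ la.map Prod.fst
  /-- `x̄ᵢ` does not occur in `tⱼ` for `i ≤ j` -/
  haFv : ∀ i j, i ≤ j → j < la.length →
      Atom.var (la.getD i default).1.1 (!(la.getD i default).1.2) ∉ (la.getD j default).2.atoms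
  /-- each member of `le` is a cut of `p` between a unit and a counit -/
  he : ∀ e ∈ le, (Tree.unit e.1, Tree.counit e.2) ∈ p.cuts ∨ (Tree.counit e.2, Tree.unit e.1) ∈ p.cuts
  heN : (le.map Prod.snd).Nodup
  /-- `jump(μᵢ) ∉ {⊥_{μⱼ}, 1_{λⱼ}}` for `i ≤ j` (in particular each eliminated
      evanescent cut is reducible) -/
  heJ : ∀ i j, i ≤ j → j < le.length →
      p.jump ((le.getD i (0,0)).2) ≠ Tree.counit ((le.getD j (0,0)).2) ∧
      p.jump ((le.getD i (0,0)).2) ≠ Tree.unit ((le.getD j (0,0)).1)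
  /-- the cuts of `q`: the remaining cuts plus the multiplicative residuals,
      under the substitution generated by the axiom cuts -/
  hcuts : q.cuts = ((p.cuts \ (melim F ∪ aelim la ∪ eelim le)) ∪ mres F).image
      (fun c => (Tree.substList la c.1, Tree.substList la c.2))
  /-- the conclusions of `q` -/
  hconcl : q.concl = p.concl.map (Tree.substList la)
  /-- the jump function of `q`, with redirections -/
  hjump : ∀ m, Tree.counit m ∈ q.ST →
      (∃ c ∈ F, p.jump m = Tree.tens c.1 ∧ q.jump m = Tree.substList la c.1.headI) ∨
      (∃ c ∈ F, p.jump m = Tree.parr c.2 ∧ q.jump m = Tree.substList la c.2.headI) ∨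
      (∃ i < la.length,
        (p.jump m = Tree.var (la.getD i default).1.1 (la.getD i default).1.2 ∨
         p.jump m = Tree.var (la.getD i default).1.1 (!(la.getD i default).1.2)) ∧
        q.jump m = Tree.substList (la.drop (i+1)) (la.getD i default).2) ∨
      (∃ i < le.length,
        (p.jump m = Tree.counit ((le.getD i (0,0)).2) ∨
         p.jump m = Tree.unit ((le.getD i (0,0)).1)) ∧
        ∃ t, Rho p le i t ∧ q.jump m = Tree.substList la t) ∨
      ((∀ c ∈ F, p.jump m ≠ Tree.tens c.1 ∧ p.jump m ≠ Tree.parr c.2) ∧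
       (∀ e ∈ la, p.jump m ≠ Tree.var e.1.1 e.1.2 ∧ p.jump m ≠ Tree.var e.1.1 (!e.1.2)) ∧
       (∀ e ∈ le, p.jump m ≠ Tree.counit e.2 ∧ p.jump m ≠ Tree.unit e.1) ∧
       q.jump m = Tree.substList la (p.jump m))

/-- Parallel elimination of a family of multiplicative cuts (`p ⇒m q`). -/
def MultStep (p q : Net) : Prop := ∃ F, ParStepF p q F [] []

/-- Parallel elimination of a family of axiom cuts (`p ⇒a q`). -/
def AxStep (p q : Net) : Prop := ∃ la, ParStepF p q ∅ la []

/-- Parallel elimination of a family of evanescent cuts (`p ⇒e q`). -/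
def EvStep (p q : Net) : Prop := ∃ le, ParStepF p q ∅ [] le

/-- A parallel cut elimination step (`p ⇒ q`), eliminating an arbitrary
    family of reducible cuts of the three kinds. -/
def ParStep (p q : Net) : Prop := ∃ F la le, ParStepF p q F la le

/-- Elimination of a single reducible cut. -/
def Step1 (p q : Net) : Prop :=
  (∃ c, ParStepF p q {c} [] []) ∨ (∃ e, ParStepF p q ∅ [e] []) ∨ (∃ e, ParStepF p q ∅ [] [e])

/-- `k` parallel cut elimination steps. -/
def ParStepN : ℕ → Net → Net → Prop
  | 0, p, q => p = q
  | k+1, p, q => ∃ r, ParStep p r ∧ ParStepN k r q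

/-! ### Evanescent cuts and the sets `Iⁿ(t)` -/

/-- `p.IsEvCut l m` : `⟨1_l | ⊥_m⟩` is a reducible evanescent cut of `p`. -/
def Net.IsEvCut (p : Net) (l m : ℕ) : Prop :=
  ((Tree.unit l, Tree.counit m) ∈ p.cuts ∨ (Tree.counit m, Tree.unit l) ∈ p.cuts) ∧
  p.jump m ≠ Tree.unit l ∧ p.jump m ≠ Tree.counit m

/-- The sets `Iⁿ(t)` of counit labels reaching `t` through a chain of `n`
    evanescent cuts. -/
noncomputable def Net.Iset (p : Net) (t : Tree) : ℕ → Finset ℕ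
  | 0 => p.counitLabels.filter fun m => p.jump m = t
  | n+1 => p.counitLabels.filter fun m' =>
      ∃ l m, p.IsEvCut l m ∧ m ∈ p.Iset t n ∧
        (p.jump m' = Tree.counit m ∨ p.jump m' = Tree.unit l)

/-- The number of evanescent cuts of `p`. -/
noncomputable def Net.evCutCount (p : Net) : ℕ :=
  (p.cuts.filter fun c => ∃ l m,
    (c = (Tree.unit l, Tree.counit m) ∨ c = (Tree.counit m, Tree.unit l)) ∧
    p.jump m ≠ Tree.unit l ∧ p.jump m ≠ Tree.counit m).card

/-! ### The function φ -/

/-- `φ(0) = 0` and `φ(n) = n + (n+1)(φ(n-1)+2)` for `n > 0`. -/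
def phi : ℕ → ℕ
  | 0 => 0
  | n + 1 => (n + 1) + (n + 2) * (phi n + 2)

/-! ### Residual edges, slipknots, bridges and bounces -/

/-- The residual cut edges in `q` of an eliminated multiplicative cut. -/
noncomputable def resEdges (c : List Tree × List Tree) : Finset Edge :=
  ((c.1.zip c.2).map fun d => Edge.cutE d.1 d.2).toFinset

/-- Canonical form of a `c`-bridge: a path bound to `c` crossing its cut edge. -/
def IsBridgeCan (c : List Tree × List Tree) (b : List Edge) : Prop :=
  ∃ pre post : List Edge,
    (pre = [] ∨ ∃ t ∈ c.1, pre = [Edge.tensE (Tree.tens c.1) t]) ∧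
    (post = [] ∨ post = [Edge.parrE (Tree.parr c.2)]) ∧
    (b = pre ++ Edge.cutE (Tree.tens c.1) (Tree.parr c.2) :: post ∨
     b = pre ++ Edge.cutE (Tree.parr c.2) (Tree.tens c.1) :: post)

/-- A `c`-bridge, in either direction. -/
def IsBridge (c : List Tree × List Tree) (b : List Edge) : Prop :=
  IsBridgeCan c b ∨ IsBridgeCan c b.reverse

/-- A `c`-bounce: a path bound to `c`, not crossing its cut edge, and
    visiting its ⊗-tree. -/
def IsBounce (c : List Tree × List Tree) (b : List Edge) : Prop :=
  b = [] ∨ (∃ t ∈ c.1, b = [Edge.tensE (Tree.tens c.1) t]) ∨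
  (∃ t ∈ c.1, ∃ t' ∈ c.1, t ≠ t' ∧
    b = [Edge.tensE (Tree.tens c.1) t, Edge.tensE (Tree.tens c.1) t'])

/-- `Gen F es es'` : the edge sequence `es'` (in `p`) is generated by the
    straight edge sequence `es` (in `q`): preserved edges are kept, and each
    residual cut edge is replaced by a bridge of the corresponding
    eliminated cut. -/
inductive Gen (F : Finset (List Tree × List Tree)) : List Edge → List Edge → Prop
  | nil : Gen F [] []
  | pres {e l l'} : (∀ c ∈ F, e ∉ resEdges c) → Gen F l l' → Gen F (e :: l) (e :: l')
  | res {c d l l' b} : c ∈ F → d ∈ resEdges c → IsBridge c b → Gen F l l' →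
      Gen F (d :: l) (b ++ l')

/-- A straight path: a path with no slipknot, i.e. crossing at most one
    residual of each eliminated cut. -/
def Straight (F : Finset (List Tree × List Tree)) (l : List (Edge × Tree)) : Prop :=
  ¬ ∃ c ∈ F, ∃ l₁ l₂ l₃ : List (Edge × Tree), ∃ d v d' v',
      d ∈ resEdges c ∧ d' ∈ resEdges c ∧ l = l₁ ++ (d, v) :: l₂ ++ (d', v') :: l₃

/-- Independent paths: disjoint, and crossing residuals of no common
    eliminated cut. -/
def Indep (F : Finset (List Tree × List Tree)) (l₁ l₂ : List (Edge × Tree)) : Prop :=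
  (∀ x ∈ l₁, ∀ y ∈ l₂, x.1 ≠ y.1) ∧
  ¬ ∃ c ∈ F, (∃ x ∈ l₁, x.1 ∈ resEdges c) ∧ (∃ y ∈ l₂, y.1 ∈ resEdges c)

/-- `DecompWith F l cs χs ξs` : the decomposition `l = χ₁ξ₁⋯χₙξₙχₙ₊₁` of a
    path of `q` into pairwise independent straight paths `χᵢ` and slipknots
    `ξᵢ` on the pairwise distinct eliminated cuts `cs = c₁, …, cₙ`. -/
def DecompWith (F : Finset (List Tree × List Tree)) (l : List (Edge × Tree))
    (cs : List (List Tree × List Tree)) (χs ξs : List (List (Edge × Tree))) : Prop :=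
  cs.Nodup ∧ (∀ c ∈ cs, c ∈ F) ∧
  χs.length = cs.length + 1 ∧ ξs.length = cs.length ∧
  l = (List.zipWith (· ++ ·) χs (ξs ++ [[]])).flatten ∧
  (∀ x ∈ χs, Straight F x ∧ ∀ c ∈ cs, ∀ y ∈ x, y.1 ∉ resEdges c) ∧
  χs.Pairwise (Indep F) ∧
  List.Forall₂ (fun (ξ : List (Edge × Tree)) (c : List Tree × List Tree) =>
      ∃ t s t' s' mid, (t, s) ∈ c.1.zip c.2 ∧ (t', s') ∈ c.1.zip c.2 ∧ t ≠ t' ∧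
        ξ = (Edge.cutE t s, s) :: mid ++ [(Edge.cutE t' s', t')]) ξs cs

/-- `Decomp F l cs` : some decomposition of `l` along the cut sequence `cs`
    exists. -/
def Decomp (F : Finset (List Tree × List Tree)) (l : List (Edge × Tree))
    (cs : List (List Tree × List Tree)) : Prop :=
  ∃ χs ξs, DecompWith F l cs χs ξs

/-! ### α-equivalence -/

/-- A renaming of atoms: a map on variable names together with a possible
    flip of polarities (so as to commute with the involution), a map on unit
    labels and a map on counit labels. -/
structure Ren : Type where
  v : ℕ → ℕ
  vb : ℕ → Bool
  u : ℕ → ℕ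
  c : ℕ → ℕ

/-- Applying a renaming to a tree. -/
def Tree.rename (r : Ren) : Tree → Tree
  | Tree.var n b => Tree.var (r.v n) (xor b (r.vb n))
  | Tree.unit l => Tree.unit (r.u l)
  | Tree.counit l => Tree.counit (r.c l)
  | Tree.tens ts => Tree.tens (ts.attach.map (fun x => Tree.rename r x.1))
  | Tree.parr ts => Tree.parr (ts.attach.map (fun x => Tree.rename r x.1))
termination_by t => sizeOf t
decreasing_by all_goals (have h := List.sizeOf_lt_of_mem x.2; simp; omega)

/-- α-equivalence of nets: renaming of atoms (preserving the involution on
    variables) and reindexing of cuts. -/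
def AlphaEq (p q : Net) : Prop :=
  ∃ r : Ren, Function.Bijective r.v ∧ Function.Bijective r.u ∧ Function.Bijective r.c ∧
    q.cuts = p.cuts.image (fun c => (c.1.rename r, c.2.rename r)) ∧
    q.concl = p.concl.map (Tree.rename r) ∧
    (∀ m, Tree.counit m ∈ p.ST → q.jump (r.c m) = (p.jump m).rename r)

end MLLNets

namespace MLLNets

section

attribute [local instance] Classical.propDecidable

theorem Tree.mem_ST_foldr {ts : List Tree} {x : Tree} :
    x ∈ (ts.attach.map (fun y => y.1.ST)).foldr (· ∪ ·) ∅ ↔ ∃ t ∈ ts, x ∈ t.ST := by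
  rw [List.attach_map_val (l := ts) (f := Tree.ST)]
  induction ts with
  | nil => simp
  | cons a l ih => simp [ih]

theorem Tree.mem_ST_tens {ts : List Tree} {x : Tree} :
    x ∈ (Tree.tens ts).ST ↔ x = Tree.tens ts ∨ ∃ t ∈ ts, x ∈ t.ST := by
  rw [Tree.ST, Finset.mem_insert, Tree.mem_ST_foldr]

theorem Tree.mem_ST_parr {ts : List Tree} {x : Tree} :
    x ∈ (Tree.parr ts).ST ↔ x = Tree.parr ts ∨ ∃ t ∈ ts, x ∈ t.ST := by
  rw [Tree.ST, Finset.mem_insert, Tree.mem_ST_foldr]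

theorem Tree.mem_atoms_attach_sum {ts : List Tree} {a : Atom} :
    a ∈ (ts.attach.map (fun y => y.1.atoms)).sum ↔ ∃ t ∈ ts, a ∈ t.atoms := by
  rw [List.attach_map_val (l := ts) (f := Tree.atoms)]
  induction ts with
  | nil => simp
  | cons b l ih => simp [ih]

theorem Tree.mem_atoms_tens {ts : List Tree} {a : Atom} :
    a ∈ (Tree.tens ts).atoms ↔ ∃ t ∈ ts, a ∈ t.atoms := by
  rw [Tree.atoms, Tree.mem_atoms_attach_sum]

theorem Tree.mem_atoms_parr {ts : List Tree} {a : Atom} :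
    a ∈ (Tree.parr ts).atoms ↔ ∃ t ∈ ts, a ∈ t.atoms := by
  rw [Tree.atoms, Tree.mem_atoms_attach_sum]

/-- A tree whose connectives all have positive arity contains an atom. -/
theorem Tree.exists_mem_atoms : ∀ t : Tree, (∀ ts, Tree.tens ts ∈ t.ST → ts ≠ []) →
    (∀ ts, Tree.parr ts ∈ t.ST → ts ≠ []) → ∃ a, a ∈ t.atoms
  | .var n b, _, _ => ⟨.var n b, by simp [Tree.atoms]⟩
  | .unit l, _, _ => ⟨.unit l, by simp [Tree.atoms]⟩
  | .counit l, _, _ => ⟨.counit l, by simp [Tree.atoms]⟩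
  | .tens [], h, _ => absurd rfl (h [] (Tree.mem_ST_tens.2 (.inl rfl)))
  | .parr [], _, h => absurd rfl (h [] (Tree.mem_ST_parr.2 (.inl rfl)))
  | .tens (t :: ts), ht, hp => by
    have hmem : t ∈ t :: ts := List.mem_cons_self
    obtain ⟨a, ha⟩ := Tree.exists_mem_atoms t
      (fun us hu => ht us (Tree.mem_ST_tens.2 (.inr ⟨t, hmem, hu⟩)))
      (fun us hu => hp us (Tree.mem_ST_tens.2 (.inr ⟨t, hmem, hu⟩)))
    exact ⟨a, Tree.mem_atoms_tens.2 ⟨t, hmem, ha⟩⟩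
  | .parr (t :: ts), ht, hp => by
    have hmem : t ∈ t :: ts := List.mem_cons_self
    obtain ⟨a, ha⟩ := Tree.exists_mem_atoms t
      (fun us hu => ht us (Tree.mem_ST_parr.2 (.inr ⟨t, hmem, hu⟩)))
      (fun us hu => hp us (Tree.mem_ST_parr.2 (.inr ⟨t, hmem, hu⟩)))
    exact ⟨a, Tree.mem_atoms_parr.2 ⟨t, hmem, ha⟩⟩

/-- `t.IsPremise u` : the tree `t` is an immediate premise of `u`. -/
def Tree.IsPremise (t u : Tree) : Prop :=
  ∃ ts, (u = Tree.tens ts ∨ u = Tree.parr ts) ∧ t ∈ ts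

theorem Tree.IsPremise.atoms_subset {t u : Tree} (h : t.IsPremise u) {a : Atom}
    (ha : a ∈ t.atoms) : a ∈ u.atoms := by
  obtain ⟨ts, rfl | rfl, ht⟩ := h
  · exact Tree.mem_atoms_tens.2 ⟨t, ht, ha⟩
  · exact Tree.mem_atoms_parr.2 ⟨t, ht, ha⟩

theorem Tree.IsPremise.ST_subset {t u : Tree} (h : t.IsPremise u) : t.ST ⊆ u.ST := by
  obtain ⟨ts, rfl | rfl, ht⟩ := h
  · exact fun x hx => Tree.mem_ST_tens.2 (.inr ⟨t, ht, hx⟩)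
  · exact fun x hx => Tree.mem_ST_parr.2 (.inr ⟨t, ht, hx⟩)

namespace Net

/-- `p.IsCutTree u` : the tree `u` is one of the two sides of a cut of `p`. -/
def IsCutTree (p : Net) (u : Tree) : Prop :=
  ∃ c ∈ p.cuts, u = c.1 ∨ u = c.2

theorem IsCutTree.ST_subset {p : Net} {u : Tree} (h : p.IsCutTree u) : u.ST ⊆ p.ST := by
  obtain ⟨c, hc, hu⟩ := h
  intro x hx
  refine Finset.mem_union_left _ (Finset.mem_biUnion.2 ⟨c, hc, Finset.mem_union.2 ?_⟩)
  rcases hu with rfl | rfl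
  · exact .inl hx
  · exact .inr hx

/-- Two sides of cuts sharing an atom are equal. -/
theorem IsCutTree.eq_of_mem_atoms {p : Net} (hp : p.atoms.Nodup) {u v : Tree} {a : Atom}
    (hu : p.IsCutTree u) (hv : p.IsCutTree v) (hau : a ∈ u.atoms) (hav : a ∈ v.atoms) :
    u = v := by
  obtain ⟨c, hc, hu⟩ := hu
  obtain ⟨d, hd, hv⟩ := hv
  let f : Tree × Tree → Multiset Atom := fun c => c.1.atoms + c.2.atoms
  have hsum : (p.cuts.sum f).Nodup :=
    Multiset.nodup_of_le (Multiset.le_add_right _ _) hp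
  have hac : a ∈ f c := by
    rcases hu with rfl | rfl <;> simp [f, hau]
  have had : a ∈ f d := by
    rcases hv with rfl | rfl <;> simp [f, hav]
  have hcd : c = d := by
    by_contra hne
    have hle : f c + f d ≤ p.cuts.sum f := by
      rw [← Finset.sum_pair hne]
      exact Finset.sum_le_sum_of_subset (by simp [Finset.insert_subset_iff, hc, hd])
    exact Multiset.disjoint_left.1
      (Multiset.nodup_add.1 (Multiset.nodup_of_le hle hsum)).2.2 hac had
  subst hcd
  have hdisj := (Multiset.nodup_add.1
    (Multiset.nodup_of_le (Finset.single_le_sum_of_canonicallyOrdered (f := f) hc) hsum)).2.2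
  rcases hu with rfl | rfl <;> rcases hv with rfl | rfl
  · rfl
  · exact (Multiset.disjoint_left.1 hdisj hau hav).elim
  · exact (Multiset.disjoint_left.1 hdisj hav hau).elim
  · rfl

/-- A tree is a premise of at most one side of a cut. -/
theorem IsCutTree.eq_of_isPremise {p : Net} (hp : p.IsMLL) {t u v : Tree}
    (hu : p.IsCutTree u) (hv : p.IsCutTree v) (htu : t.IsPremise u) (htv : t.IsPremise v) :
    u = v := by
  have hsub : t.ST ⊆ p.ST := htu.ST_subset.trans hu.ST_subset
  obtain ⟨a, ha⟩ := t.exists_mem_atoms (fun ts h => hp.2.1 ts (hsub h))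
    (fun ts h => hp.2.2.1 ts (hsub h))
  exact hu.eq_of_mem_atoms hp.1 hv (htu.atoms_subset ha) (htv.atoms_subset ha)

theorem mem_counitLabels {p : Net} {m : ℕ} :
    m ∈ p.counitLabels ↔ Tree.counit m ∈ p.ST := by
  rw [counitLabels, Finset.mem_biUnion]
  constructor
  · rintro ⟨t, ht, hm⟩
    cases t <;> simp_all
  · exact fun h => ⟨_, h, by simp⟩

theorem card_jump_le_jd {p : Net} (hp : p.IsMLL) (t : Tree) :
    (p.counitLabels.filter fun m => p.jump m = t).card ≤ p.jd := by
  by_cases ht : t ∈ p.ST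
  · exact Finset.le_sup (f := fun t => (p.counitLabels.filter fun m => p.jump m = t).card) ht
  · rw [Finset.filter_eq_empty_iff.2, Finset.card_empty]
    · exact Nat.zero_le _
    · rintro m hm rfl
      exact ht (hp.2.2.2.2 m (mem_counitLabels.1 hm))

end Net

namespace ParStepF

variable {p q : Net} {F : Finset (List Tree × List Tree)}

theorem isCutTree_tens {la : List ((ℕ × Bool) × Tree)} {le : List (ℕ × ℕ)}
    (h : ParStepF p q F la le) {c : List Tree × List Tree} (hc : c ∈ F) :
    p.IsCutTree (Tree.tens c.1) := by
  rcases (h.hF c hc).2.2 with h' | h'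
  · exact ⟨_, h', .inl rfl⟩
  · exact ⟨_, h', .inr rfl⟩

theorem isCutTree_parr {la : List ((ℕ × Bool) × Tree)} {le : List (ℕ × ℕ)}
    (h : ParStepF p q F la le) {c : List Tree × List Tree} (hc : c ∈ F) :
    p.IsCutTree (Tree.parr c.2) := by
  rcases (h.hF c hc).2.2 with h' | h'
  · exact ⟨_, h', .inr rfl⟩
  · exact ⟨_, h', .inl rfl⟩

theorem ST_subset (h : ParStepF p q F [] []) : q.ST ⊆ p.ST := by
  have hconcl : q.concl = p.concl := by
    rw [h.hconcl]
    exact List.map_id _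
  have hcuts : q.cuts ⊆ p.cuts ∪ mres F := by
    intro d hd
    rw [h.hcuts] at hd
    obtain ⟨e, he, rfl⟩ := Finset.mem_image.1 hd
    exact Finset.union_subset_union_left Finset.sdiff_subset he
  intro x hx
  rw [Net.ST, hconcl, Finset.mem_union] at hx
  rcases hx with hx | hx
  · obtain ⟨d, hd, hx⟩ := Finset.mem_biUnion.1 hx
    rcases Finset.mem_union.1 (hcuts hd) with hd | hd
    · exact Finset.mem_union_left _ (Finset.mem_biUnion.2 ⟨d, hd, hx⟩)
    · obtain ⟨c, hc, hd⟩ := Finset.mem_biUnion.1 hd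
      have hz := List.of_mem_zip (List.mem_toFinset.1 hd)
      rcases Finset.mem_union.1 hx with hx | hx
      · exact (h.isCutTree_tens hc).ST_subset
          (Tree.IsPremise.ST_subset ⟨_, .inl rfl, hz.1⟩ hx)
      · exact (h.isCutTree_parr hc).ST_subset
          (Tree.IsPremise.ST_subset ⟨_, .inr rfl, hz.2⟩ hx)
  · exact Finset.mem_union_right _ hx

/-- After a multiplicative step, a counit jumping to `t` previously jumped to `t` or to a cut
tree having `t` as a premise. -/
theorem jump_eq_or_isPremise (h : ParStepF p q F [] []) {m : ℕ} (hm : Tree.counit m ∈ q.ST) :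
    p.jump m = q.jump m ∨
      p.IsCutTree (p.jump m) ∧ (q.jump m).IsPremise (p.jump m) := by
  have head_mem : ∀ {l : List Tree}, l ≠ [] → l.headI ∈ l := by
    intro l hl
    cases l with
    | nil => exact absurd rfl hl
    | cons a l => exact List.mem_cons_self
  rcases h.hjump m hm with ⟨c, hc, hpm, hqm⟩ | ⟨c, hc, hpm, hqm⟩ | ⟨i, hi, _⟩ | ⟨i, hi, _⟩ |
    ⟨_, _, _, hqm⟩
  · refine .inr ⟨hpm ▸ h.isCutTree_tens hc, c.1, .inl hpm, ?_⟩
    rw [hqm]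
    exact head_mem (h.hF c hc).2.1
  · refine .inr ⟨hpm ▸ h.isCutTree_parr hc, c.2, .inr hpm, ?_⟩
    rw [hqm]
    refine head_mem fun hnil => (h.hF c hc).2.1 (List.length_eq_zero_iff.1 ?_)
    rw [(h.hF c hc).1, hnil, List.length_nil]
  · exact absurd hi (Nat.not_lt_zero _)
  · exact absurd hi (Nat.not_lt_zero _)
  · exact .inl hqm.symm

end ParStepF

end

/-- If `p` and `q` are acyclic MLL proof nets and
    `p ⇒m q`, then `jd(q) ≤ 2·jd(p)`. -/
theorem mult_jd_bound (p q : Net)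
    (hp : p.IsMLL) (hq : q.IsMLL) (hpa : p.IsAcyclic) (hqa : q.IsAcyclic)
    (h : MultStep p q) :
    q.jd ≤ 2 * p.jd := by
  classical
  obtain ⟨F, h⟩ := h
  refine Finset.sup_le fun t _ => ?_
  obtain ⟨u, hu⟩ : ∃ u, ∀ v, p.IsCutTree v → t.IsPremise v → v = u := by
    by_cases hex : ∃ u, p.IsCutTree u ∧ t.IsPremise u
    · obtain ⟨u, hu, htu⟩ := hex
      exact ⟨u, fun v hv htv => hv.eq_of_isPremise hp hu htv htu⟩
    · exact ⟨t, fun v hv htv => (hex ⟨v, hv, htv⟩).elim⟩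
  have hsub : (q.counitLabels.filter fun m => q.jump m = t) ⊆
      (p.counitLabels.filter fun m => p.jump m = t) ∪
        (p.counitLabels.filter fun m => p.jump m = u) := by
    intro m hm
    obtain ⟨hml, rfl⟩ := Finset.mem_filter.1 hm
    have hmq := Net.mem_counitLabels.1 hml
    have hmp := Net.mem_counitLabels.2 (h.ST_subset hmq)
    rcases h.jump_eq_or_isPremise hmq with heq | ⟨hcut, hprem⟩
    · exact Finset.mem_union_left _ (Finset.mem_filter.2 ⟨hmp, heq⟩)
    · exact Finset.mem_union_right _ (Finset.mem_filter.2 ⟨hmp, hu _ hcut hprem⟩)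
  calc _ ≤ _ := Finset.card_le_card hsub
    _ ≤ _ := Finset.card_union_le _ _
    _ ≤ p.jd + p.jd := add_le_add (Net.card_jump_le_jd hp t) (Net.card_jump_le_jd hp u)
    _ = 2 * p.jd := (two_mul _).symm

end MLLNets
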